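/- arXiv:2410.04121 — 2 statements merged into one kernel-verified Lean document; each statement's English description precedes it below -/
import Mathlib

section
/- For every function v : ℕ → ℝ with bounded growth of derivative there exists a function w : ℕ → ℕ of the same growth type as v such that: w(0) = 1; for all n ∈ ℕ, 2 ≤ w(n+2) − w(n+1) ≤ 2·(w(n+1) − w(n)); and there exist a real λ with 1 < λ < 2 and a constant C > 0 such that w(n) ≤ C·λ^n for all n ∈ ℕ. -/
/-- A function `v : ℕ → ℝ` has bounded growth of derivative (is a bgd-function)
if it takes positive values and there is a positive integer `L` such that
`1/L ≤ v (n+2) - v (n+1) ≤ L * (v (n+1) - v n)` for all `n`. -/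
def BGDFunction (v : ℕ → ℝ) : Prop :=
  (∀ n, 0 < v n) ∧
    ∃ L : ℕ, 0 < L ∧ ∀ n : ℕ,
      (1 : ℝ) / L ≤ v (n + 2) - v (n + 1) ∧
        v (n + 2) - v (n + 1) ≤ L * (v (n + 1) - v n)

/-- Two functions `f h : ℕ → ℝ` are of the same growth type if there is an
integer `A ≥ 1` with `f n ≤ A * h (A*n + A) + A` and `h n ≤ A * f (A*n + A) + A`
for all `n`. -/
def SameGrowthType (f h : ℕ → ℝ) : Prop :=
  ∃ A : ℕ, 1 ≤ A ∧ ∀ n : ℕ,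
    f n ≤ A * h (A * n + A) + A ∧ h n ≤ A * f (A * n + A) + A

/-- The largest sequence starting at `T 0` which is bounded by `T m` on the block
`[k * m, k * (m + 1))` and grows at each step at most by the factor `3 / 2`. -/
def slowedSequence (T : ℕ → ℕ) (k : ℕ) : ℕ → ℕ
  | 0 => T 0
  | n + 1 => min (3 * slowedSequence T k n / 2) (T ((n + 1) / k))

/-- The sequence with initial value `1` and increments `slowedSequence T k`. -/
def slowedSum (T : ℕ → ℕ) (k n : ℕ) : ℕ :=
  1 + ∑ i ∈ Finset.range n, slowedSequence T k i

lemma slowedSum_succ (T : ℕ → ℕ) (k n : ℕ) :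
    slowedSum T k (n + 1) = slowedSum T k n + slowedSequence T k n := by
  simp [slowedSum, Finset.sum_range_succ, add_assoc]

lemma slowedSum_mono (T : ℕ → ℕ) (k : ℕ) : Monotone (slowedSum T k) :=
  monotone_nat_of_le_succ fun n => by rw [slowedSum_succ]; omega

lemma slowedSequence_le (T : ℕ → ℕ) (k n : ℕ) : slowedSequence T k n ≤ T (n / k) := by
  cases n with
  | zero => simp [slowedSequence]
  | succ n => simp [slowedSequence]

lemma two_le_slowedSequence {T : ℕ → ℕ} (hT : ∀ m, 2 ≤ T m) (k n : ℕ) :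
    2 ≤ slowedSequence T k n := by
  induction n with
  | zero => exact hT 0
  | succ n ih =>
    have := hT ((n + 1) / k)
    simp only [slowedSequence]
    omega

lemma slowedSequence_succ_le (T : ℕ → ℕ) (k n : ℕ) :
    2 * slowedSequence T k (n + 1) ≤ 3 * slowedSequence T k n := by
  simp only [slowedSequence]
  omega

lemma slowedSequence_le_pow (T : ℕ → ℕ) (k n : ℕ) :
    (slowedSequence T k n : ℝ) ≤ T 0 * (3 / 2) ^ n := by
  induction n with
  | zero => simp [slowedSequence]
  | succ n ih =>
    have h : (2 * slowedSequence T k (n + 1) : ℝ) ≤ 3 * slowedSequence T k n := by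
      exact_mod_cast slowedSequence_succ_le T k n
    rw [pow_succ]
    linarith

lemma slowedSum_le_pow (T : ℕ → ℕ) (k n : ℕ) :
    (slowedSum T k n : ℝ) ≤ 1 + 2 * T 0 * ((3 / 2) ^ n - 1) := by
  induction n with
  | zero => simp [slowedSum]
  | succ n ih =>
    have h := slowedSequence_le_pow T k n
    rw [slowedSum_succ, pow_succ]
    push_cast
    linarith

lemma slowedSequence_block_growth {T : ℕ → ℕ} (hT : ∀ m, 2 ≤ T m) {k : ℕ} (m j : ℕ) (hj : j < k) :
    T m ≤ slowedSequence T k (k * m + j) ∨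
      (4 / 3 : ℝ) ^ j * slowedSequence T k (k * m) ≤ slowedSequence T k (k * m + j) := by
  induction j with
  | zero => simp
  | succ j ih =>
    have h2 := two_le_slowedSequence hT k (k * m + j)
    have hdiv : (k * m + j + 1) / k = m := by
      rw [add_assoc, Nat.mul_add_div (by omega), Nat.div_eq_of_lt hj, add_zero]
    have hstep : slowedSequence T k (k * m + (j + 1)) =
        min (3 * slowedSequence T k (k * m + j) / 2) (T m) := by
      rw [← add_assoc, slowedSequence, hdiv]
    rcases le_total (T m) (3 * slowedSequence T k (k * m + j) / 2) with hle | hle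
    · left
      rw [hstep, min_eq_right hle]
    rw [min_eq_left hle] at hstep
    rcases ih (by omega) with ih | ih
    · left
      omega
    · right
      have h : (4 * slowedSequence T k (k * m + j) : ℝ) ≤
          3 * slowedSequence T k (k * m + (j + 1)) := by
        norm_cast
        omega
      rw [pow_succ]
      linarith

lemma le_slowedSequence_block_end {T : ℕ → ℕ} (hT : ∀ m, 2 ≤ T m) {K k : ℕ}
    (hK : ∀ m, T (m + 1) ≤ K * T m) (hk : (K : ℝ) ≤ (4 / 3) ^ k) (m : ℕ) :
    T m ≤ slowedSequence T (k + 1) ((k + 1) * m + k) := by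
  have hone : (1 : ℝ) ≤ (4 / 3) ^ k := one_le_pow₀ (by norm_num)
  induction m with
  | zero =>
    rcases slowedSequence_block_growth hT 0 k k.lt_succ_self with h | h
    · exact h
    · have h0 : slowedSequence T (k + 1) ((k + 1) * 0) = T 0 := rfl
      rw [h0] at h
      exact_mod_cast (le_mul_of_one_le_left (Nat.cast_nonneg (T 0)) hone).trans h
  | succ m ih =>
    rcases slowedSequence_block_growth hT (m + 1) k k.lt_succ_self with h | h
    · exact h
    have hstart : min (T m) (T (m + 1)) ≤ slowedSequence T (k + 1) ((k + 1) * (m + 1)) := by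
      have hidx : (k + 1) * (m + 1) = (k + 1) * m + k + 1 := by ring
      have hdiv : ((k + 1) * m + k + 1) / (k + 1) = m + 1 := by
        rw [← hidx]; exact Nat.mul_div_cancel_left _ k.succ_pos
      rw [hidx, slowedSequence, hdiv]
      omega
    have hgoal : (T (m + 1) : ℝ) ≤
        (4 / 3) ^ k * slowedSequence T (k + 1) ((k + 1) * (m + 1)) := by
      rcases min_le_iff.1 hstart with hs | hs
      · calc (T (m + 1) : ℝ) ≤ K * T m := by exact_mod_cast hK m
          _ ≤ _ := by gcongr
      · have hs' : (T (m + 1) : ℝ) ≤ slowedSequence T (k + 1) ((k + 1) * (m + 1)) := by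
          exact_mod_cast hs
        exact hs'.trans (le_mul_of_one_le_left (Nat.cast_nonneg _) hone)
    exact_mod_cast hgoal.trans h

lemma slowedSum_block_le (T : ℕ → ℕ) {k : ℕ} (m j : ℕ) (hj : j ≤ k) :
    slowedSum T k (k * m + j) ≤ slowedSum T k (k * m) + j * T m := by
  induction j with
  | zero => simp
  | succ j ih =>
    have h := slowedSequence_le T k (k * m + j)
    rw [Nat.mul_add_div (by omega), Nat.div_eq_of_lt (by omega), add_zero] at h
    rw [← add_assoc, slowedSum_succ, add_mul]
    have := ih (by omega)
    omega

lemma slowedSum_mul_le (T : ℕ → ℕ) (k n : ℕ) :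
    slowedSum T k (k * n) ≤ 1 + k * ∑ m ∈ Finset.range n, T m := by
  induction n with
  | zero => simp [slowedSum]
  | succ n ih =>
    have h := slowedSum_block_le T n k le_rfl
    rw [Finset.sum_range_succ, mul_add, mul_add, mul_one]
    omega

lemma sum_le_slowedSum {T : ℕ → ℕ} (hT : ∀ m, 2 ≤ T m) {K k : ℕ}
    (hK : ∀ m, T (m + 1) ≤ K * T m) (hk : (K : ℝ) ≤ (4 / 3) ^ k) (n : ℕ) :
    ∑ m ∈ Finset.range n, T m ≤ slowedSum T (k + 1) ((k + 1) * n) := by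
  induction n with
  | zero => simp
  | succ n ih =>
    have h := le_slowedSequence_block_end hT hK hk n
    have hmono : slowedSum T (k + 1) ((k + 1) * n) ≤ slowedSum T (k + 1) ((k + 1) * n + k) :=
      slowedSum_mono T (k + 1) (by omega)
    have hidx : (k + 1) * (n + 1) = (k + 1) * n + k + 1 := by ring
    rw [Finset.sum_range_succ, hidx, slowedSum_succ]
    omega

theorem bgd_normalization (v : ℕ → ℝ) (hv : BGDFunction v) :
    ∃ w : ℕ → ℕ,
      SameGrowthType (fun n => (w n : ℝ)) v ∧
      w 0 = 1 ∧
      (∀ n : ℕ, (2 : ℝ) ≤ (w (n + 2) : ℝ) - w (n + 1) ∧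
        (w (n + 2) : ℝ) - w (n + 1) ≤ 2 * ((w (n + 1) : ℝ) - w n)) ∧
      ∃ lam C : ℝ, 1 < lam ∧ lam < 2 ∧ 0 < C ∧ ∀ n : ℕ, (w n : ℝ) ≤ C * lam ^ n := by
  obtain ⟨hpos, L, hL, hbgd⟩ := hv
  have hL1 : (1 : ℝ) ≤ L := by exact_mod_cast hL
  have hL0 : (0 : ℝ) < L := by linarith
  have hd : ∀ n, 1 ≤ (L : ℝ) ^ 2 * (v (n + 1) - v n) := fun n => by
    have h := (hbgd n).1.trans (hbgd n).2
    rw [div_le_iff₀ hL0] at h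
    linarith
  have hd0 : ∀ n, 0 ≤ v (n + 1) - v n := fun n =>
    (pos_of_mul_pos_right (zero_lt_one.trans_le (hd n)) (by positivity)).le
  have hvmono : Monotone v := monotone_nat_of_le_succ fun n => sub_nonneg.1 (hd0 n)
  set T : ℕ → ℕ := fun m => ⌈v (m + 1) - v m⌉₊ + 2 with hTdef
  have hT2 : ∀ m, 2 ≤ T m := fun m => Nat.le_add_left _ _
  have hTge : ∀ m, v (m + 1) - v m + 2 ≤ T m := fun m => by
    have := Nat.le_ceil (v (m + 1) - v m)
    simp only [hTdef]
    push_cast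
    linarith
  have hTle : ∀ m, (T m : ℝ) ≤ v (m + 1) - v m + 3 := fun m => by
    have := Nat.ceil_lt_add_one (hd0 m)
    simp only [hTdef]
    push_cast
    linarith
  have hTK : ∀ m, T (m + 1) ≤ (2 * L) * T m := fun m => by
    have h1 := hTle (m + 1)
    have h2 := (hbgd m).2
    have h3 : (L : ℝ) * (v (m + 1) - v m + 2) ≤ L * T m := by gcongr; exact hTge m
    have h4 := mul_nonneg hL0.le (hd0 m)
    have h5 : (T (m + 1) : ℝ) ≤ (2 * L) * T m := by
      rw [mul_assoc]
      linarith
    exact_mod_cast h5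
  obtain ⟨k, hk⟩ := pow_unbounded_of_one_lt ((2 * L : ℕ) : ℝ) (by norm_num : (1 : ℝ) < 4 / 3)
  have hlower : ∀ n, v n ≤ v 0 + slowedSum T (k + 1) ((k + 1) * n) := fun n => by
    have h1 : v n - v 0 ≤ ∑ m ∈ Finset.range n, (T m : ℝ) := by
      rw [← Finset.sum_range_sub]
      exact Finset.sum_le_sum fun m _ => by linarith [hTge m]
    have h2 : (∑ m ∈ Finset.range n, (T m : ℝ)) ≤ slowedSum T (k + 1) ((k + 1) * n) := by
      exact_mod_cast sum_le_slowedSum hT2 hTK hk.le n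
    linarith
  have hupper : ∀ n, (slowedSum T (k + 1) n : ℝ) ≤
      1 + (k + 1) * (1 + 3 * (L : ℝ) ^ 2) * v n := fun n => by
    have h1 : (∑ m ∈ Finset.range n, (T m : ℝ)) ≤ (1 + 3 * (L : ℝ) ^ 2) * (v n - v 0) := by
      rw [← Finset.sum_range_sub, Finset.mul_sum]
      exact Finset.sum_le_sum fun m _ => by linarith [hTle m, hd m]
    have h2 : (slowedSum T (k + 1) n : ℝ) ≤ 1 + (k + 1) * ∑ m ∈ Finset.range n, (T m : ℝ) := by
      exact_mod_cast (slowedSum_mono T (k + 1) (Nat.le_mul_of_pos_left n k.succ_pos)).trans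
        (slowedSum_mul_le T (k + 1) n)
    have h3 : (1 + 3 * (L : ℝ) ^ 2) * (v n - v 0) ≤ (1 + 3 * (L : ℝ) ^ 2) * v n := by
      gcongr
      linarith [hpos 0]
    calc (slowedSum T (k + 1) n : ℝ) ≤ 1 + (k + 1) * ∑ m ∈ Finset.range n, (T m : ℝ) := h2
      _ ≤ 1 + (k + 1) * ((1 + 3 * (L : ℝ) ^ 2) * v n) := by
        gcongr
        exact h1.trans h3
      _ = _ := by ring
  refine ⟨slowedSum T (k + 1), ?_, by simp [slowedSum], fun n => ?_,
    3 / 2, 1 + 2 * T 0, by norm_num, by norm_num, by positivity, fun n => ?_⟩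
  · set A : ℕ := (k + 1) * (1 + 3 * L ^ 2) + ⌈v 0⌉₊ with hA
    have hkA : k + 1 ≤ A :=
      (Nat.le_mul_of_pos_right (k + 1) (by positivity)).trans (Nat.le_add_right _ _)
    have hA1 : (1 : ℝ) ≤ A := by exact_mod_cast (Nat.le_add_left 1 k).trans hkA
    have hcA : (k + 1) * (1 + 3 * (L : ℝ) ^ 2) ≤ A := by
      exact_mod_cast Nat.le_add_right ((k + 1) * (1 + 3 * L ^ 2)) ⌈v 0⌉₊
    have hvA : v 0 ≤ A := (Nat.le_ceil _).trans (by exact_mod_cast Nat.le_add_left _ _)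
    refine ⟨A, (Nat.le_add_left 1 k).trans hkA, fun n => ⟨?_, ?_⟩⟩
    · have hn : n ≤ A * n + A :=
        (Nat.le_mul_of_pos_left n (by omega)).trans (Nat.le_add_right _ _)
      have h : (k + 1) * (1 + 3 * (L : ℝ) ^ 2) * v n ≤ A * v (A * n + A) :=
        mul_le_mul hcA (hvmono hn) (hpos n).le (by positivity)
      linarith [hupper n]
    · have hn : (k + 1) * n ≤ A * n + A :=
        (Nat.mul_le_mul_right n hkA).trans (Nat.le_add_right _ _)
      have h1 : (slowedSum T (k + 1) ((k + 1) * n) : ℝ) ≤ slowedSum T (k + 1) (A * n + A) := by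
        exact_mod_cast slowedSum_mono T (k + 1) hn
      have h2 : (slowedSum T (k + 1) (A * n + A) : ℝ) ≤ A * slowedSum T (k + 1) (A * n + A) :=
        le_mul_of_one_le_left (Nat.cast_nonneg _) hA1
      linarith [hlower n]
  · have h2 : (2 : ℝ) ≤ slowedSequence T (k + 1) (n + 1) := by
      exact_mod_cast two_le_slowedSequence hT2 (k + 1) (n + 1)
    have h3 : (2 * slowedSequence T (k + 1) (n + 1) : ℝ) ≤ 3 * slowedSequence T (k + 1) n := by
      exact_mod_cast slowedSequence_succ_le T (k + 1) n
    rw [slowedSum_succ T (k + 1) (n + 1), slowedSum_succ T (k + 1) n]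
    push_cast
    constructor <;> linarith
  · have hone : (1 : ℝ) ≤ (3 / 2) ^ n := one_le_pow₀ (by norm_num)
    have hT0 : (0 : ℝ) ≤ T 0 := Nat.cast_nonneg _
    linarith [slowedSum_le_pow T (k + 1) n]
end

section
/- For every sequence t : ℕ → ℕ of positive integers and every natural number d, there exists a strictly increasing sequence n : ℕ → ℕ with n(0) ≥ d and n(j) + t(j) < n(j+1) for all j ∈ ℕ, such that the set S = ⋃_{j ∈ ℕ} {n(j), n(j)+1, …, n(j) + t(j) − 1} has vanishing lower density. -/
open Filter

/-- A subset `S ⊆ ℕ` has vanishing lower density if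
`liminf_{n → ∞} |S ∩ {0, …, n}| / n = 0`. -/
def VanishingLowerDensity (S : Set ℕ) : Prop :=
  Filter.liminf (fun n : ℕ => ((S ∩ Set.Iic n).ncard : ℝ) / n) Filter.atTop = 0

/-- If a nonnegative real sequence has a subsequence tending to `0`, its lower limit is `0`. -/
theorem liminf_eq_zero_of_tendsto_comp {u : ℕ → ℝ} (hu : ∀ n, 0 ≤ u n) {m : ℕ → ℕ}
    (hm : Tendsto m atTop atTop) (hum : Tendsto (u ∘ m) atTop (nhds 0)) :
    liminf u atTop = 0 := by
  have hfreq : ∀ ε > 0, ∃ᶠ n in atTop, u n ≤ ε := fun ε hε =>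
    hm.frequently (hum.eventually_le_const hε).frequently
  have hbdd : IsBoundedUnder (· ≥ ·) atTop u := isBoundedUnder_of ⟨0, hu⟩
  have hcobdd : IsCoboundedUnder (· ≥ ·) atTop u :=
    IsCoboundedUnder.of_frequently_le (hfreq 1 one_pos)
  apply le_antisymm
  · exact le_of_forall_pos_le_add fun ε hε => by
      simpa using liminf_le_of_frequently_le (hfreq ε hε) hbdd
  · exact le_liminf_of_le hcobdd (Eventually.of_forall hu)

/-- Starting points of intervals of lengths `t j`, separated by rapidly growing gaps. -/
def sparseStart (t : ℕ → ℕ) (d : ℕ) : ℕ → ℕ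
  | 0 => d
  | j + 1 => (j + 1) * (sparseStart t d j + t j) + 1

theorem sparseStart_add_lt (t : ℕ → ℕ) (d j : ℕ) :
    sparseStart t d j + t j < sparseStart t d (j + 1) :=
  Nat.lt_succ_of_le (Nat.le_mul_of_pos_left _ j.succ_pos)

theorem strictMono_sparseStart (t : ℕ → ℕ) (d : ℕ) : StrictMono (sparseStart t d) :=
  strictMono_nat_of_lt_succ fun j => (Nat.le_add_right _ _).trans_lt (sparseStart_add_lt t d j)

theorem ncard_iUnion_Ico_inter_Iic_le {n t : ℕ → ℕ} (hn : StrictMono n)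
    (hnt : ∀ j, n j + t j < n (j + 1)) {j m : ℕ} (hm : m < n (j + 1)) :
    ((⋃ i, Set.Ico (n i) (n i + t i)) ∩ Set.Iic m).ncard ≤ n j + t j := by
  have hsub : (⋃ i, Set.Ico (n i) (n i + t i)) ∩ Set.Iic m ⊆ Set.Iio (n j + t j) := by
    rintro x ⟨hx, hxm⟩
    obtain ⟨i, hi, hi'⟩ := Set.mem_iUnion.1 hx
    simp only [Set.mem_Iic, Set.mem_Iio] at hxm ⊢
    have hij : i < j + 1 := hn.lt_iff_lt.1 (by omega)
    rcases (Nat.lt_succ_iff.1 hij).eq_or_lt with rfl | h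
    · exact hi'
    · have h1 := hn.monotone (Nat.succ_le_of_lt h)
      have h2 := hnt i
      simp only [Nat.succ_eq_add_one] at h1
      omega
  simpa [Set.ncard_eq_toFinset_card'] using Set.ncard_le_ncard hsub (Set.finite_Iio _)

theorem exists_sparse_intervals (t : ℕ → ℕ) (ht : ∀ j, 0 < t j) (d : ℕ) :
    ∃ n : ℕ → ℕ, StrictMono n ∧ d ≤ n 0 ∧
      (∀ j : ℕ, n j + t j < n (j + 1)) ∧
      VanishingLowerDensity (⋃ j : ℕ, Set.Ico (n j) (n j + t j)) := by
  refine ⟨sparseStart t d, strictMono_sparseStart t d, le_rfl, sparseStart_add_lt t d, ?_⟩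
  have hpos : ∀ j, 0 < sparseStart t d j + t j := fun j => Nat.add_pos_right _ (ht j)
  refine liminf_eq_zero_of_tendsto_comp (fun n => by positivity)
    (m := fun j => (j + 1) * (sparseStart t d j + t j)) ?_ ?_
  · exact tendsto_atTop_mono
      (fun j => (Nat.le_succ j).trans (Nat.le_mul_of_pos_right _ (hpos j))) tendsto_id
  · refine squeeze_zero (fun j => by simp only [Function.comp]; positivity) (fun j => ?_)
      (tendsto_one_div_add_atTop_nhds_zero_nat (𝕜 := ℝ))
    have hcard := ncard_iUnion_Ico_inter_Iic_le (strictMono_sparseStart t d)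
      (sparseStart_add_lt t d) (j := j) (Nat.lt_succ_self ((j + 1) * (sparseStart t d j + t j)))
    have hpos' : (0 : ℝ) < ((sparseStart t d j + t j : ℕ) : ℝ) := by exact_mod_cast hpos j
    simp only [Function.comp]
    rw [Nat.cast_mul, div_le_div_iff₀ (by positivity) (by positivity), one_mul, mul_comm]
    push_cast at hcard ⊢
    exact mul_le_mul_of_nonneg_left (by exact_mod_cast hcard) (by positivity)
end
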